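/- The intersection of an arbitrary family of verbally closed subgroups of a free group F_r of finite rank is again verbally closed. (Equivalently, by the main theorem, the intersection of an arbitrary family of retracts of F_r is a retract.) -/

import Mathlib

/-- `H` is verbally closed in `G`: for every word `w` and `h ∈ H`, if the
equation `w(x₁,…,xₙ) = h` has a solution in `G` then it has one in `H`. -/
def VerballyClosedIn {G : Type*} [Group G] (H : Subgroup G) : Prop :=
  ∀ (n : ℕ) (w : FreeGroup (Fin n)) (h : G), h ∈ H →
    (∃ x : Fin n → G, FreeGroup.lift x w = h) →
    (∃ x : Fin n → G, (∀ j, x j ∈ H) ∧ FreeGroup.lift x w = h)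

namespace FreeGroup

open Function

/-- Extending a partial injection of a finite set, a nontrivial element of a free group
acts nontrivially on the finite set of suffixes of its reduced word. -/
theorem exists_hom_perm_ne_one {α : Type*} {w : FreeGroup α} (hw : w ≠ 1) :
    ∃ (n : ℕ) (χ : FreeGroup α →* Equiv.Perm (Fin n)), χ w ≠ 1 := by
  classical
  let V : Finset (FreeGroup α) := (w.toWord.tails.map mk).toFinset
  have hV : ∀ L, L <:+ w.toWord → mk L ∈ V := fun L hL =>
    List.mem_toFinset.2 (List.mem_map.2 ⟨L, (List.mem_tails _ _).2 hL, rfl⟩)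
  let e (a : α) : {v : V // of a * v ∈ V} ≃ {v : V // (of a)⁻¹ * v ∈ V} :=
    { toFun := fun v => ⟨⟨of a * v.1, v.2⟩, by simp⟩
      invFun := fun v => ⟨⟨(of a)⁻¹ * v.1, v.2⟩, by simp⟩
      left_inv := fun v => by simp
      right_inv := fun v => by simp }
  let χ : FreeGroup α →* Equiv.Perm V := lift fun a => (e a).extendSubtype
  have hpos (a : α) (v : FreeGroup α) (h : v ∈ V) (h' : of a * v ∈ V) :
      χ (of a) ⟨v, h⟩ = ⟨of a * v, h'⟩ := by
    simp only [χ, lift_apply_of]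
    rw [Equiv.extendSubtype_apply_of_mem (e a) ⟨v, h⟩ h']
    rfl
  have key : ∀ L, L <:+ w.toWord → ∀ u (hu : u ∈ V), u = mk L →
      χ u ⟨1, hV [] List.nil_suffix⟩ = ⟨u, hu⟩ := by
    intro L
    induction L with
    | nil =>
      rintro - u hu rfl
      simp only [← one_eq_mk, _root_.map_one, Equiv.Perm.coe_one, id_eq]
    | cons x L ih =>
      rintro hL u hu rfl
      have hL' : L <:+ w.toWord := (List.suffix_cons x L).trans hL
      have hu' := hV L hL'
      have ih := ih hL' _ hu' rfl
      obtain ⟨a, b⟩ := x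
      cases b
      · have h1 : mk L = of a * mk ((a, false) :: L) := by
          rw [← mul_inv_cancel_left (of a) (mk L)]
          simp [of, inv_mk, mul_mk, invRev]
        have h2 := hpos a _ hu (h1 ▸ hu')
        have h3 : mk ((a, false) :: L) = (of a)⁻¹ * mk L := by rw [h1, inv_mul_cancel_left]
        have h4 : (⟨of a * mk ((a, false) :: L), h1 ▸ hu'⟩ : V) = ⟨mk L, hu'⟩ :=
          Subtype.ext h1.symm
        rw [h4, ← ih] at h2
        rw [congrArg χ h3, _root_.map_mul, Equiv.Perm.mul_apply, ← h2, _root_.map_inv,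
          Equiv.Perm.inv_def, Equiv.symm_apply_apply]
      · have h1 : mk ((a, true) :: L) = of a * mk L := by simp [of, mul_mk]
        rw [congrArg χ h1, _root_.map_mul, Equiv.Perm.mul_apply, ih, hpos a _ _ (h1 ▸ hu)]
        exact Subtype.ext h1.symm
  have hχ : χ w ≠ 1 := by
    intro h
    have hwV : w ∈ V := by simpa [mk_toWord] using hV _ (List.suffix_refl w.toWord)
    have := key _ (List.suffix_refl _) w hwV mk_toWord.symm
    rw [h] at this
    exact hw (congrArg Subtype.val this).symm
  refine ⟨_, (Fintype.equivFin V).permCongrHom.toMonoidHom.comp χ, fun h => hχ ?_⟩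
  exact (Fintype.equivFin V).permCongrHom.injective (h.trans (_root_.map_one _).symm)

/-- Finitely generated free groups are Hopfian. -/
theorem injective_of_surjective {α : Type*} [Finite α] (θ : FreeGroup α →* FreeGroup α)
    (hθ : Surjective θ) : Injective θ := by
  rw [injective_iff_map_eq_one]
  intro w hw
  by_contra hne
  obtain ⟨n, χ, hχ⟩ := exists_hom_perm_ne_one hne
  have : Finite (FreeGroup α →* Equiv.Perm (Fin n)) := Finite.of_equiv _ lift
  have hinj : Injective fun f : FreeGroup α →* Equiv.Perm (Fin n) => f.comp θ :=
    fun f g h => (MonoidHom.cancel_right hθ).1 h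
  obtain ⟨f, rfl⟩ := (Finite.injective_iff_surjective.1 hinj) χ
  exact hχ (by simp [hw])

/-- If restriction along `f` is injective on mod 2 characters, the rank does not increase. -/
theorem finite_and_card_le_of_injective {α β : Type*} [Finite α]
    (f : FreeGroup α →* FreeGroup β)
    (hf : Injective fun χ : FreeGroup β →* Multiplicative (ZMod 2) => χ.comp f) :
    Finite β ∧ Nat.card β ≤ Nat.card α := by
  have i1 : Finite (FreeGroup α →* Multiplicative (ZMod 2)) := Finite.of_equiv _ lift
  have i2 : Finite (FreeGroup β →* Multiplicative (ZMod 2)) := Finite.of_injective _ hf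
  have i3 : Finite (β → Multiplicative (ZMod 2)) := Finite.of_equiv _ lift.symm
  have i4 : Finite β := by
    classical
    refine Finite.of_injective
      (fun b : β => Pi.mulSingle (M := fun _ => Multiplicative (ZMod 2)) b
        (Multiplicative.ofAdd 1)) fun b c h => ?_
    by_contra hne
    have := congrFun h b
    simp [hne] at this
  refine ⟨i4, ?_⟩
  have h1 := Nat.card_le_card_of_injective _ hf
  rw [← Nat.card_congr (lift (α := α) (β := Multiplicative (ZMod 2))),
    ← Nat.card_congr (lift (α := β) (β := Multiplicative (ZMod 2))), Nat.card_fun,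
    Nat.card_fun] at h1
  have h2 : Nat.card (Multiplicative (ZMod 2)) = 2 := by simp
  rw [h2] at h1
  exact (Nat.pow_le_pow_iff_right (by norm_num)).1 h1

theorem finite_and_card_le_of_surjective {α β : Type*} [Finite α]
    (f : FreeGroup α →* FreeGroup β) (hf : Surjective f) :
    Finite β ∧ Nat.card β ≤ Nat.card α :=
  finite_and_card_le_of_injective f fun _ _ h => (MonoidHom.cancel_right hf).1 h

/-- A homomorphism between free groups factors through its image, which is free of
rank at most that of the source. -/
theorem exists_factor {α β : Type*} [Finite α] (θ : FreeGroup α →* FreeGroup β) :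
    ∃ k ≤ Nat.card α, ∃ (q : FreeGroup α →* FreeGroup (Fin k))
        (j : FreeGroup (Fin k) →* FreeGroup β),
      Surjective q ∧ Injective j ∧ j.comp q = θ := by
  let e : θ.range ≃* FreeGroup (IsFreeGroup.Generators θ.range) := IsFreeGroup.toFreeGroup _
  have hs : Surjective (e.toMonoidHom.comp θ.rangeRestrict) :=
    e.surjective.comp θ.rangeRestrict_surjective
  obtain ⟨hfin, hcard⟩ := finite_and_card_le_of_surjective _ hs
  let e' := freeGroupCongr (Finite.equivFin (IsFreeGroup.Generators θ.range))
  refine ⟨_, hcard, e'.toMonoidHom.comp (e.toMonoidHom.comp θ.rangeRestrict),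
    θ.range.subtype.comp (e.symm.toMonoidHom.comp e'.symm.toMonoidHom), e'.surjective.comp hs,
    Subtype.val_injective.comp (e.symm.injective.comp e'.symm.injective), ?_⟩
  ext a
  simp

theorem injective_of_surjective_of_le {k l : ℕ} (hle : k ≤ l)
    (q : FreeGroup (Fin k) →* FreeGroup (Fin l)) (hq : Surjective q) : Injective q := by
  have := (finite_and_card_le_of_surjective q hq).2
  simp only [Nat.card_eq_fintype_card, Fintype.card_fin] at this
  obtain rfl := le_antisymm hle this
  exact injective_of_surjective q hq

/-- An element of a free group of rank `k` is full if it lies in no retract of smaller rank. -/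
def IsFull {k : ℕ} (g : FreeGroup (Fin k)) : Prop :=
  ∀ k' < k, ∀ (i : FreeGroup (Fin k') →* FreeGroup (Fin k))
    (p : FreeGroup (Fin k) →* FreeGroup (Fin k')), p.comp i = MonoidHom.id _ → i (p g) ≠ g

theorem IsFull.eq_id {k : ℕ} {g : FreeGroup (Fin k)} (hg : IsFull g)
    (ρ : FreeGroup (Fin k) →* FreeGroup (Fin k)) (hρ : ∀ x, ρ (ρ x) = ρ x) (h : ρ g = g)
    (x : FreeGroup (Fin k)) : ρ x = x := by
  obtain ⟨k', hk, q, j, hq, hj, rfl⟩ := exists_factor ρ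
  have hqj : q.comp j = MonoidHom.id _ := by
    refine MonoidHom.ext fun y => ?_
    obtain ⟨x, rfl⟩ := hq y
    exact hj (hρ x)
  simp only [Nat.card_eq_fintype_card, Fintype.card_fin] at hk
  obtain hlt | rfl := hk.lt_or_eq
  · exact absurd h (hg k' hlt j q hqj)
  · exact injective_of_surjective q hq (DFunLike.congr_fun hqj (q x))

theorem exists_isFull_retract {r : ℕ} (g : FreeGroup (Fin r)) :
    ∃ k ≤ r, ∃ (i : FreeGroup (Fin k) →* FreeGroup (Fin r))
      (p : FreeGroup (Fin r) →* FreeGroup (Fin k)),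
      p.comp i = MonoidHom.id _ ∧ i (p g) = g ∧ IsFull (p g) := by
  classical
  have hex : ∃ k, ∃ (i : FreeGroup (Fin k) →* FreeGroup (Fin r))
      (p : FreeGroup (Fin r) →* FreeGroup (Fin k)), p.comp i = MonoidHom.id _ ∧ i (p g) = g :=
    ⟨r, MonoidHom.id _, MonoidHom.id _, rfl, rfl⟩
  obtain ⟨i, p, hpi, hg⟩ := Nat.find_spec hex
  refine ⟨_, Nat.find_le ⟨MonoidHom.id _, MonoidHom.id _, rfl, rfl⟩, i, p, hpi, hg, ?_⟩
  intro k' hk' i' p' hpi' h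
  refine Nat.find_min hex hk' ⟨i.comp i', p'.comp p, ?_, ?_⟩
  · rw [MonoidHom.comp_assoc, ← MonoidHom.comp_assoc _ i p, hpi, MonoidHom.id_comp, hpi']
  · simp only [MonoidHom.comp_apply, h, hg]

/-- A cocycle for an action of a free group is freely determined by its values on a basis. -/
theorem exists_cocycle {α V Γ : Type*} [Group Γ] (π : FreeGroup α →* Equiv.Perm V)
    (c₀ : α → V → Γ) :
    ∃ c : FreeGroup α → V → Γ, (∀ a, c (of a) = c₀ a) ∧
      ∀ x y v, c (x * y) v = c x (π y v) * c y v := by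
  let e (a : α) : Equiv.Perm (V × Γ) :=
    { toFun := fun z => (π (of a) z.1, c₀ a z.1 * z.2)
      invFun := fun z => ((π (of a)).symm z.1, (c₀ a ((π (of a)).symm z.1))⁻¹ * z.2)
      left_inv := fun z => by simp
      right_inv := fun z => by simp }
  let Ψ : FreeGroup α →* Equiv.Perm (V × Γ) := lift e
  have hΨ : ∀ x v γ, Ψ x (v, γ) = (π x v, (Ψ x (v, 1)).2 * γ) := by
    intro x
    induction x using FreeGroup.induction_on with
    | C1 => simp
    | of a => intro v γ; simp [Ψ, e]
    | inv_of a _ =>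
      intro v γ
      simp only [_root_.map_inv, Ψ, lift_apply_of]
      refine Prod.ext rfl ?_
      change (c₀ a ((π (of a)).symm v))⁻¹ * γ = (c₀ a ((π (of a)).symm v))⁻¹ * 1 * γ
      rw [mul_one]
    | mul x y hx hy =>
      intro v γ
      simp only [_root_.map_mul, Equiv.Perm.mul_apply]
      rw [hy, hx, hy v 1, hx _ (_ * 1)]
      simp [mul_assoc]
  refine ⟨fun x v => (Ψ x (v, 1)).2, fun a => ?_, fun x y v => ?_⟩
  · ext v; simp [Ψ, e]
  · simp only [_root_.map_mul, Equiv.Perm.mul_apply]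
    rw [hΨ y, hΨ x]

section Cocycle

variable {α V Γ : Type*} [Group Γ] {π : FreeGroup α →* Equiv.Perm V} {c : FreeGroup α → V → Γ}

theorem cocycle_one (hc : ∀ x y v, c (x * y) v = c x (π y v) * c y v) (v : V) : c 1 v = 1 := by
  have := hc 1 1 v
  simpa using this

theorem cocycle_inv (hc : ∀ x y v, c (x * y) v = c x (π y v) * c y v) (x : FreeGroup α)
    (v : V) : c x⁻¹ (π x v) = (c x v)⁻¹ := by
  have := hc x⁻¹ x v
  rw [inv_mul_cancel, cocycle_one hc] at this
  exact eq_inv_of_mul_eq_one_left this.symm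

end Cocycle

/-- An element of a free group lies, up to retraction, in finitely many subgroups. -/
theorem exists_finite_retracts {α : Type*} [Finite α] (g : FreeGroup α) :
    ∃ 𝒦 : Set (Subgroup (FreeGroup α)), 𝒦.Finite ∧ ∀ K : Subgroup (FreeGroup α), g ∈ K →
      ∃ K₀ ∈ 𝒦, K₀ ≤ K ∧ g ∈ K₀ ∧ ∃ ρ : K →* FreeGroup α,
        (∀ x, ρ x ∈ K₀) ∧ ∀ x (hx : x ∈ K), x ∈ K₀ → ρ ⟨x, hx⟩ = x := by
  classical
  let Q : Set (FreeGroup α) := mk '' {L | L ∈ g.toWord.tails}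
  have hQfin : Q.Finite := (List.finite_toSet _).image _
  have hQ : ∀ L, L <:+ g.toWord → mk L ∈ Q := fun L hL => ⟨L, (List.mem_tails _ _).2 hL, rfl⟩
  have hQ1 : (1 : FreeGroup α) ∈ Q := hQ [] List.nil_suffix
  have hQg : g ∈ Q := by simpa [mk_toWord] using hQ _ (List.suffix_refl g.toWord)
  let S : Set (FreeGroup α) :=
    (fun z : FreeGroup α × α × FreeGroup α => z.1⁻¹ * of z.2.1 * z.2.2) '' (Q ×ˢ Set.univ ×ˢ Q)
  have hSfin : S.Finite := (hQfin.prod (Set.finite_univ.prod hQfin)).image _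
  refine ⟨Subgroup.closure '' {T | T ⊆ S}, hSfin.finite_subsets.image _, fun K hgK => ?_⟩
  let K₀ := Subgroup.closure (S ∩ K)
  have hK₀ : K₀ ≤ K := (Subgroup.closure_le K).2 Set.inter_subset_right
  let π : FreeGroup α →* Equiv.Perm (FreeGroup α ⧸ K) := MulAction.toPermHom _ _
  have hπ : ∀ x y : FreeGroup α, π x (y : FreeGroup α ⧸ K) =
      ((x * y : FreeGroup α) : FreeGroup α ⧸ K) :=
    fun x y => rfl
  obtain ⟨t, ht1, htQ⟩ : ∃ t : FreeGroup α ⧸ K → FreeGroup α,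
      t ((1 : FreeGroup α) : FreeGroup α ⧸ K) = 1 ∧ ∀ q ∈ Q, t (q : FreeGroup α ⧸ K) ∈ Q ∧
        ((t (q : FreeGroup α ⧸ K) : FreeGroup α) : FreeGroup α ⧸ K) = (q : FreeGroup α ⧸ K) := by
    have : ∀ v : FreeGroup α ⧸ K, ∃ u : FreeGroup α,
        (v = ((1 : FreeGroup α) : FreeGroup α ⧸ K) → u = 1) ∧
        ∀ q ∈ Q, (q : FreeGroup α ⧸ K) = v → u ∈ Q ∧ (u : FreeGroup α ⧸ K) = v := by
      intro v
      by_cases h1 : v = ((1 : FreeGroup α) : FreeGroup α ⧸ K)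
      · exact ⟨1, fun _ => rfl, fun q _ _ => ⟨hQ1, h1.symm⟩⟩
      · by_cases h2 : ∃ q ∈ Q, (q : FreeGroup α ⧸ K) = v
        · obtain ⟨q, hq, hqv⟩ := h2
          exact ⟨q, fun h => absurd h h1, fun _ _ _ => ⟨hq, hqv⟩⟩
        · exact ⟨1, fun _ => rfl, fun q hq hqv => absurd ⟨q, hq, hqv⟩ h2⟩
    choose t ht using this
    exact ⟨t, (ht _).1 rfl, fun q hq => (ht _).2 q hq rfl⟩
  obtain ⟨c, hc₀, hc⟩ := exists_cocycle π fun a v =>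
    if (∃ q ∈ Q, (q : FreeGroup α ⧸ K) = v) ∧ (∃ q ∈ Q, (q : FreeGroup α ⧸ K) = π (of a) v)
    then (t (π (of a) v))⁻¹ * of a * t v else 1
  have hcK₀ : ∀ x v, c x v ∈ K₀ := by
    intro x
    induction x using FreeGroup.induction_on with
    | C1 => intro v; rw [cocycle_one hc]; exact one_mem _
    | of a =>
      intro v
      rw [hc₀]
      dsimp only
      split_ifs with h
      · obtain ⟨⟨q, hq, rfl⟩, q', hq', h'⟩ := h
        refine Subgroup.subset_closure ⟨⟨(_, a, _), ⟨?_, trivial, (htQ q hq).1⟩, rfl⟩, ?_⟩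
        · rw [← h']; exact (htQ q' hq').1
        · rw [mul_assoc]
          refine QuotientGroup.eq.1 ?_
          rw [← h', (htQ q' hq').2, h', ← hπ, (htQ q hq).2]
      · exact one_mem _
    | inv_of a ih =>
      intro v
      obtain ⟨u, rfl⟩ := (π (of a)).surjective v
      rw [cocycle_inv hc]
      exact inv_mem (ih u)
    | mul x y hx hy => intro v; rw [hc]; exact mul_mem (hx _) (hy _)
  have hstep : ∀ a, ∀ q ∈ Q, ∀ q' ∈ Q,
      ((of a * q : FreeGroup α) : FreeGroup α ⧸ K) = (q' : FreeGroup α ⧸ K) →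
      c (of a) (q : FreeGroup α ⧸ K) =
        (t (q' : FreeGroup α ⧸ K))⁻¹ * of a * t (q : FreeGroup α ⧸ K) := by
    intro a q hq q' hq' h
    rw [hc₀]
    dsimp only
    rw [hπ, h, if_pos ⟨⟨q, hq, rfl⟩, q', hq', rfl⟩]
  have hcQ : ∀ L, L <:+ g.toWord → c (mk L) ((1 : FreeGroup α) : FreeGroup α ⧸ K) =
      (t (mk L : FreeGroup α ⧸ K))⁻¹ * mk L := by
    intro L
    induction L with
    | nil => intro _; simp only [← one_eq_mk, cocycle_one hc, ht1]; simp
    | cons x L ih =>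
      intro hL
      have hL' : L <:+ g.toWord := (List.suffix_cons x L).trans hL
      have ih := ih hL'
      obtain ⟨a, b⟩ := x
      cases b
      · have h1 : mk L = of a * mk ((a, false) :: L) := by
          rw [← mul_inv_cancel_left (of a) (mk L)]
          simp [of, inv_mk, mul_mk, invRev]
        have h2 := hc (of a) (mk ((a, false) :: L)) ((1 : FreeGroup α) : FreeGroup α ⧸ K)
        rw [← h1, ih, hπ, mul_one, hstep a _ (hQ _ hL) _ (hQ _ hL') (by rw [← h1])] at h2
        rw [eq_inv_mul_iff_mul_eq]
        refine mul_left_cancel (a := (t (mk L : FreeGroup α ⧸ K))⁻¹ * of a) ?_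
        rw [← mul_assoc, ← h2, mul_assoc _ (of a), ← h1]
      · have h1 : mk ((a, true) :: L) = of a * mk L := by simp [of, mul_mk]
        rw [h1, hc, ih, hπ, mul_one, hstep a _ (hQ _ hL') _ (hQ _ hL) (by rw [← h1]), ← h1]
        simp only [h1]
        group
  have hcQ' : ∀ q ∈ Q, c q ((1 : FreeGroup α) : FreeGroup α ⧸ K) =
      (t (q : FreeGroup α ⧸ K))⁻¹ * q := by
    rintro _ ⟨L, hL, rfl⟩
    exact hcQ L ((List.mem_tails _ _).1 hL)
  have hone : ∀ x ∈ K, (x : FreeGroup α ⧸ K) = ((1 : FreeGroup α) : FreeGroup α ⧸ K) :=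
    fun x hx => QuotientGroup.eq.2 (by simpa using hx)
  have hcK : ∀ x y, y ∈ K → c (x * y) ((1 : FreeGroup α) : FreeGroup α ⧸ K) =
      c x ((1 : FreeGroup α) : FreeGroup α ⧸ K) * c y ((1 : FreeGroup α) : FreeGroup α ⧸ K) := by
    intro x y hy
    rw [hc, hπ, mul_one, hone y hy]
  let ρ : K →* FreeGroup α :=
    { toFun := fun x => c x ((1 : FreeGroup α) : FreeGroup α ⧸ K)
      map_one' := cocycle_one hc _
      map_mul' := fun x y => hcK x y y.2 }
  refine ⟨K₀, ⟨_, Set.inter_subset_left, rfl⟩, hK₀, ?_, ρ, fun x => hcK₀ _ _, ?_⟩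
  · have := hcK₀ g ((1 : FreeGroup α) : FreeGroup α ⧸ K)
    rwa [hcQ' g hQg, hone g hgK, ht1, inv_one, one_mul] at this
  · intro x hx hx₀
    change c x _ = x
    induction hx₀ using Subgroup.closure_induction with
    | mem x h =>
      obtain ⟨⟨⟨q', a, q⟩, ⟨hq', -, hq⟩, rfl⟩, hxK⟩ := h
      have h1 : ((of a * q : FreeGroup α) : FreeGroup α ⧸ K) = (q' : FreeGroup α ⧸ K) := by
        refine (QuotientGroup.eq.2 ?_).symm
        simpa [mul_assoc] using hxK
      have h2 := cocycle_inv hc q' ((1 : FreeGroup α) : FreeGroup α ⧸ K)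
      rw [hπ, mul_one, hcQ' q' hq'] at h2
      dsimp only
      rw [mul_assoc, hc, hπ, mul_one, h1, h2, hc, hπ, mul_one, hstep a q hq q' hq' h1, hcQ' q hq]
      group
    | one => exact cocycle_one hc _
    | mul x y hx' hy' ihx ihy =>
      rw [hcK x y (hK₀ hy'), ihx (hK₀ hx'), ihy (hK₀ hy')]
    | inv x hx' ih =>
      have := cocycle_inv hc x ((1 : FreeGroup α) : FreeGroup α ⧸ K)
      rwa [hπ, mul_one, hone x (hK₀ hx'), ih (hK₀ hx')] at this

/-- Turner: an endomorphism fixing a full element is an automorphism. -/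
theorem IsFull.bijective {k : ℕ} {g : FreeGroup (Fin k)} (hg : IsFull g)
    (θ : Monoid.End (FreeGroup (Fin k))) (h : θ g = g) : Bijective θ := by
  induction k using Nat.strong_induction_on with
  | _ k IH =>
  have hθ : Injective θ := by
    obtain ⟨k', hk, q, j, hq, hj, hjq⟩ := exists_factor θ
    have hjq' : ∀ x, j (q x) = θ x := DFunLike.congr_fun hjq
    simp only [Nat.card_eq_fintype_card, Fintype.card_fin] at hk
    obtain hlt | rfl := hk.lt_or_eq
    · obtain ⟨k'', hk'', i, p, hpi, hfix, hfull⟩ := exists_isFull_retract (q g)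
      let J : FreeGroup (Fin k'') →* FreeGroup (Fin k) := j.comp i
      let f : FreeGroup (Fin k) →* FreeGroup (Fin k'') := p.comp q
      have hJ : J (f g) = g := by simp only [J, f, MonoidHom.comp_apply, hfix, hjq', h]
      have hbij : Bijective (f.comp J) :=
        IH k'' (hk''.trans_lt hlt) hfull (f.comp J) (by
          change f (J (f g)) = f g
          rw [hJ])
      let e : FreeGroup (Fin k'') ≃* FreeGroup (Fin k'') := MulEquiv.ofBijective _ hbij
      have he : ∀ x, e x = f (J x) := fun _ => rfl
      refine absurd ?_ (hg k'' (hk''.trans_lt hlt) J (e.symm.toMonoidHom.comp f) ?_)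
      · have : e.symm (f g) = f g := by
          rw [MulEquiv.symm_apply_eq, he, hJ]
        simp [this, hJ]
      · refine MonoidHom.ext fun x => ?_
        exact e.symm_apply_apply x
    · rw [← hjq]
      exact hj.comp (injective_of_surjective q hq)
  refine ⟨hθ, ?_⟩
  have hpow : ∀ n : ℕ, Injective ⇑(θ ^ n) := fun n => by
    rw [Monoid.End.coe_pow]; exact hθ.iterate n
  have hpowg : ∀ n : ℕ, (θ ^ n) g = g := fun n => by
    rw [Monoid.End.coe_pow]; exact iterate_fixed h n
  obtain ⟨𝒦, hfin, h𝒦⟩ := exists_finite_retracts g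
  have hmem : ∀ n : ℕ, MonoidHom.range (θ ^ n) ∈ 𝒦 := by
    intro n
    obtain ⟨K₀, hK₀, hle, hgK₀, ρ, hρ, hρid⟩ := h𝒦 (MonoidHom.range (θ ^ n)) ⟨g, hpowg n⟩
    let e : FreeGroup (Fin k) ≃* MonoidHom.range (θ ^ n) := MonoidHom.ofInjective (hpow n)
    have he : ∀ x, (e x : FreeGroup (Fin k)) = (θ ^ n) x := fun x => rfl
    let σ : FreeGroup (Fin k) →* FreeGroup (Fin k) :=
      e.symm.toMonoidHom.comp ((ρ.codRestrict _ fun x => hle (hρ x)).comp e.toMonoidHom)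
    have heσ : ∀ x, (e (σ x) : FreeGroup (Fin k)) = ρ (e x) := fun x => by simp [σ]
    have hσ : ∀ x, σ x = x := by
      refine hg.eq_id σ (fun x => ?_) ?_
      · refine e.injective (Subtype.ext ?_)
        rw [heσ (σ x), heσ x]
        have := hρid (e (σ x)) (e (σ x)).2 (heσ x ▸ hρ _)
        rw [← heσ x, ← this]
      · refine e.injective (Subtype.ext ?_)
        rw [heσ]
        have h1 : e g = ⟨g, ⟨g, hpowg n⟩⟩ := Subtype.ext (hpowg n)
        rw [h1]
        exact hρid g _ hgK₀
    have : MonoidHom.range (θ ^ n) = K₀ := by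
      refine le_antisymm ?_ hle
      rintro _ ⟨x, rfl⟩
      change (θ ^ n) x ∈ K₀
      rw [← he, ← hσ x, heσ]
      exact hρ _
    rwa [this]
  obtain ⟨a, b, hab, heq⟩ := hfin.exists_lt_map_eq_of_forall_mem hmem
  intro x
  have hx : (θ ^ a) x ∈ MonoidHom.range (θ ^ b) := heq ▸ ⟨x, rfl⟩
  obtain ⟨y, hy⟩ := hx
  obtain ⟨d, rfl⟩ := Nat.exists_eq_add_of_lt hab
  refine ⟨(θ ^ d) y, hpow a ?_⟩
  rw [← hy, add_assoc, pow_add, pow_succ']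
  rfl

/-- The inverse of a letter. -/
def letterInv {α : Type*} (x : α × Bool) : α × Bool := (x.1, !x.2)

section Whitehead

variable {α : Type*}

@[simp] theorem letterInv_letterInv (x : α × Bool) : letterInv (letterInv x) = x := by
  simp [letterInv]

theorem letterInv_ne (x : α × Bool) : letterInv x ≠ x := by
  simp [letterInv, Prod.ext_iff]

theorem mk_letterInv (x : α × Bool) : mk [letterInv x] = (mk [x])⁻¹ := by
  rw [inv_mk]; rfl

open Classical in
/-- The Whitehead endomorphism fixing the generator `i` and multiplying the letters in `S`
on the left by `u`. -/
noncomputable def whitehead (S : Set (α × Bool)) (i : α) (u : FreeGroup α) :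
    FreeGroup α →* FreeGroup α :=
  lift fun a => if a = i then of a else
    (if (a, true) ∈ S then u else 1) * of a * (if (a, false) ∈ S then u else 1)⁻¹

theorem whitehead_whitehead_inv (S : Set (α × Bool)) (i : α) {u : FreeGroup α}
    (hu : whitehead S i u u = u) (x : FreeGroup α) :
    whitehead S i u (whitehead S i u⁻¹ x) = x := by
  classical
  refine DFunLike.congr_fun (f := (whitehead S i u).comp (whitehead S i u⁻¹))
    (g := MonoidHom.id _) (ext_hom _ _ fun a => ?_) x
  simp only [MonoidHom.comp_apply, MonoidHom.id_apply]
  by_cases ha : a = i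
  · simp [whitehead, ha]
  · by_cases h1 : (a, true) ∈ S <;> by_cases h2 : (a, false) ∈ S <;>
    · have h3 : whitehead S i u (of a) = (if (a, true) ∈ S then u else 1) * of a *
          (if (a, false) ∈ S then u else 1)⁻¹ := by simp [whitehead, ha]
      have h4 : whitehead S i u⁻¹ (of a) = (if (a, true) ∈ S then u⁻¹ else 1) * of a *
          (if (a, false) ∈ S then u⁻¹ else 1)⁻¹ := by simp [whitehead, ha]
      rw [h4]
      simp only [h1, h2, if_true, if_false, _root_.map_mul, _root_.map_inv, _root_.map_one, hu, h3]
      group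

theorem whitehead_self (S : Set (α × Bool)) (y : α × Bool) :
    ∀ u, whitehead S y.1 u (mk [y]) = mk [y] := by
  intro u
  obtain ⟨a, b⟩ := y
  cases b
  · have : mk [(a, false)] = (of a)⁻¹ := by simp [of, inv_mk, invRev]
    simp [this, whitehead]
  · change whitehead S a u (of a) = of a
    simp [whitehead]

/-- The Whitehead automorphism with multiplier the letter `y`. -/
noncomputable def whiteheadEquiv (S : Set (α × Bool)) (y : α × Bool) :
    FreeGroup α ≃* FreeGroup α :=
  MonoidHom.toMulEquiv (whitehead S y.1 (mk [y])) (whitehead S y.1 (mk [y])⁻¹)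
    (MonoidHom.ext fun x => by
      have := whitehead_whitehead_inv S y.1 (u := (mk [y])⁻¹)
        (by rw [_root_.map_inv, whitehead_self]) x
      rwa [inv_inv] at this)
    (MonoidHom.ext fun x => whitehead_whitehead_inv S y.1 (whitehead_self S y _) x)

open Classical in
/-- The initial syllable of the image of the letter `x` under a Whitehead automorphism. -/
noncomputable def whiteheadHead (S : Set (α × Bool)) (y x : α × Bool) : FreeGroup α :=
  if x ∈ S ∨ x = y then mk [y] else 1

open Classical in
/-- The central syllable of the image of the letter `x` under a Whitehead automorphism. -/
noncomputable def whiteheadCore (y x : α × Bool) : FreeGroup α :=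
  if x = y ∨ letterInv x = y then 1 else mk [x]

theorem whiteheadEquiv_letter {S : Set (α × Bool)} {y : α × Bool} (hy : y ∉ S)
    (hy' : letterInv y ∉ S) (x : α × Bool) :
    whiteheadEquiv S y (mk [x]) =
      whiteheadHead S y x * whiteheadCore y x * (whiteheadHead S y (letterInv x))⁻¹ := by
  change whitehead S y.1 (mk [y]) (mk [x]) = _
  by_cases h1 : x = y
  · subst h1
    rw [whitehead_self]
    simp [whiteheadHead, whiteheadCore, letterInv_ne, hy']
  by_cases h2 : letterInv x = y
  · subst h2
    rw [letterInv_letterInv] at hy'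
    have h3 : mk [x] = (mk [letterInv x])⁻¹ := by rw [mk_letterInv, inv_inv]
    conv_lhs => rw [h3, _root_.map_inv, whitehead_self]
    simp [whiteheadHead, whiteheadCore, hy', h1]
  obtain ⟨a, b⟩ := x
  have ha : a ≠ y.1 := by
    rintro rfl
    obtain ⟨a, c⟩ := y
    cases b <;> cases c <;> simp_all [letterInv]
  cases b
  · have h3 : mk [(a, false)] = (of a)⁻¹ := by simp [of, inv_mk, invRev]
    have h4 : letterInv (a, false) = (a, true) := rfl
    rw [h4] at h2 ⊢
    by_cases h5 : (a, true) ∈ S <;> by_cases h6 : (a, false) ∈ S <;>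
      simp [whiteheadHead, whiteheadCore, h1, h2, h3, h4, h5, h6, whitehead, ha, mul_assoc]
  · have h3 : mk [(a, true)] = of a := rfl
    have h4 : letterInv (a, true) = (a, false) := rfl
    rw [h4] at h2 ⊢
    by_cases h5 : (a, true) ∈ S <;> by_cases h6 : (a, false) ∈ S <;>
      simp [whiteheadHead, whiteheadCore, h1, h2, h3, h4, h5, h6, whitehead, ha, mul_assoc]

end Whitehead

section Whitehead

variable {α : Type*} [DecidableEq α]

open Classical in
theorem norm_whitehead_turn {S : Set (α × Bool)} {y p q : α × Bool} (hy : y ∉ S)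
    (hy' : letterInv y ∉ S) (h₁ : letterInv p ∈ S → q ∈ S ∨ q = y)
    (h₂ : q ∈ S → letterInv p ∈ S ∨ letterInv p = y) :
    (whiteheadCore y p * (whiteheadHead S y (letterInv p))⁻¹ * whiteheadHead S y q).norm +
        (if p = y then 1 else 0) ≤ 1 + (if q = y then 1 else 0) ∧
      (¬ (letterInv p ∈ S ↔ q ∈ S) →
        (whiteheadCore y p * (whiteheadHead S y (letterInv p))⁻¹ * whiteheadHead S y q).norm +
        (if p = y then 1 else 0) < 1 + (if q = y then 1 else 0)) := by
  have n1 : ∀ x : α × Bool, norm (mk [x]) = 1 := fun x => rfl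
  have n2 : (mk [p] * mk [y]).norm ≤ 2 := (norm_mul_le _ _).trans (by rw [n1, n1])
  by_cases c1 : p = y
  · subst c1
    by_cases c2 : q = p
    · subst c2
      simp [-mul_mk, -inv_mk, n1, whiteheadCore, whiteheadHead, hy, hy', letterInv_ne]
    · have c3 : q ∉ S := fun h => by simpa [hy', letterInv_ne] using h₂ h
      simp [-mul_mk, -inv_mk, whiteheadCore, whiteheadHead, hy', letterInv_ne, c2, c3]
  by_cases c2 : letterInv p = y
  · subst c2
    by_cases c3 : q = letterInv p
    · subst c3
      simp [-mul_mk, -inv_mk, whiteheadCore, whiteheadHead, (letterInv_ne p).symm, hy]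
    · by_cases c4 : q ∈ S
      · simp [-mul_mk, -inv_mk, whiteheadCore, whiteheadHead, (letterInv_ne p).symm, c3, c4, hy]
      · simp [-mul_mk, -inv_mk, norm_inv_eq, n1, whiteheadCore, whiteheadHead,
          (letterInv_ne p).symm, c3, c4, hy]
  by_cases c3 : letterInv p ∈ S
  · rcases h₁ c3 with c4 | rfl
    · by_cases c5 : q = y
      · exact absurd (c5 ▸ c4) hy
      · simp [-mul_mk, -inv_mk, n1, whiteheadCore, whiteheadHead, c1, c2, c3, c4, c5]
    · simp [-mul_mk, -inv_mk, n1, whiteheadCore, whiteheadHead, c1, c2, c3]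
  · have c4 : q ∉ S := fun h => by simpa [c2, c3] using h₂ h
    by_cases c5 : q = y
    · subst c5
      simpa [-mul_mk, -inv_mk, whiteheadCore, whiteheadHead, c1, c2, c3, hy] using n2
    · simp [-mul_mk, -inv_mk, n1, whiteheadCore, whiteheadHead, c1, c2, c3, c4, c5]

open Classical in
theorem norm_whitehead_chain {S : Set (α × Bool)} {y : α × Bool} (hy : y ∉ S)
    (hy' : letterInv y ∉ S) (z : α × Bool) (l : List (α × Bool)) :
    ∀ x, List.IsChain (fun p q => (letterInv p ∈ S → q ∈ S ∨ q = y) ∧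
        (q ∈ S → letterInv p ∈ S ∨ letterInv p = y)) (x :: (l ++ [z])) →
      ∃ g : FreeGroup α, whiteheadEquiv S y (mk (x :: l)) * whiteheadHead S y z =
          whiteheadHead S y x * g ∧
        g.norm + (if x = y then 1 else 0) ≤ l.length + 1 + (if z = y then 1 else 0) ∧
        (¬ List.IsChain (fun p q => letterInv p ∈ S ↔ q ∈ S) (x :: (l ++ [z])) →
          g.norm + (if x = y then 1 else 0) < l.length + 1 + (if z = y then 1 else 0)) := by
  induction l with
  | nil =>
    intro x hch
    simp only [List.nil_append, List.isChain_cons_cons, List.isChain_singleton, and_true] at hch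
    have := norm_whitehead_turn hy hy' hch.1 hch.2
    refine ⟨_, ?_, by simpa using this.1, by simpa using this.2⟩
    rw [whiteheadEquiv_letter hy hy']
    group
  | cons w l ih =>
    intro x hch
    rw [List.cons_append, List.isChain_cons_cons] at hch
    obtain ⟨g, h1, h2, h3⟩ := ih w hch.2
    have h4 := norm_whitehead_turn hy hy' hch.1.1 hch.1.2
    refine ⟨(whiteheadCore y x * (whiteheadHead S y (letterInv x))⁻¹ * whiteheadHead S y w) * g,
      ?_, ?_, fun hg => ?_⟩
    · have : mk (x :: w :: l) = mk [x] * mk (w :: l) := by simp [mul_mk]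
      rw [this, _root_.map_mul, mul_assoc, h1, whiteheadEquiv_letter hy hy']
      group
    · have := norm_mul_le (whiteheadCore y x * (whiteheadHead S y (letterInv x))⁻¹ *
        whiteheadHead S y w) g
      have := h4.1
      simp only [List.length_cons]
      omega
    · have := norm_mul_le (whiteheadCore y x * (whiteheadHead S y (letterInv x))⁻¹ *
        whiteheadHead S y w) g
      rw [List.cons_append, List.isChain_cons_cons, not_and_or] at hg
      simp only [List.length_cons]
      rcases hg with hg | hg
      · have := h4.2 hg
        omega
      · have := h3 hg
        have := h4.1
        omega

/-- A word is Whitehead minimal if no automorphism makes it shorter. -/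
def IsMinimalWord (L : List (α × Bool)) : Prop :=
  ∀ a : FreeGroup α ≃* FreeGroup α, L.length ≤ (a (mk L)).norm

theorem IsMinimalWord.chain_iff {L : List (α × Bool)} (hL : IsMinimalWord L)
    {S : Set (α × Bool)} {y : α × Bool} (hy : y ∉ S) (hy' : letterInv y ∉ S)
    (h : Cycle.Chain (fun p q => (letterInv p ∈ S → q ∈ S ∨ q = y) ∧
        (q ∈ S → letterInv p ∈ S ∨ letterInv p = y)) (L : Cycle (α × Bool))) :
    Cycle.Chain (fun p q => letterInv p ∈ S ↔ q ∈ S) (L : Cycle (α × Bool)) := by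
  classical
  cases L with
  | nil => simp
  | cons x l =>
    rw [Cycle.chain_coe_cons] at h ⊢
    obtain ⟨g, h1, -, h3⟩ := norm_whitehead_chain hy hy' x l x h
    by_contra hcon
    have h4 := h3 hcon
    have h5 := hL ((whiteheadEquiv S y).trans (MulAut.conj (whiteheadHead S y x)⁻¹))
    have h6 : ((whiteheadEquiv S y).trans (MulAut.conj (whiteheadHead S y x)⁻¹)) (mk (x :: l)) =
        g := by
      simp only [MulEquiv.trans_apply, MulAut.conj_apply, inv_inv]
      rw [mul_assoc, h1]
      group
    rw [h6] at h5
    simp only [List.length_cons] at h5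
    omega

theorem IsMinimalWord.rotate {A C : List (α × Bool)} (h : IsMinimalWord (A ++ C)) :
    IsMinimalWord (C ++ A) := by
  intro a
  have := h ((MulAut.conj (mk A)⁻¹).trans a)
  have h1 : (MulAut.conj (mk A)⁻¹) (mk (A ++ C)) = mk (C ++ A) := by
    rw [MulAut.conj_apply, ← mul_mk, ← mul_mk]
    group
  rw [MulEquiv.trans_apply, h1] at this
  simpa [add_comm] using this

theorem IsMinimalWord.invRev {L : List (α × Bool)} (h : IsMinimalWord L) :
    IsMinimalWord (invRev L) := by
  intro a
  rw [← inv_mk, _root_.map_inv, norm_inv_eq, invRev_length]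
  exact h a

theorem IsMinimalWord.isReduced {L : List (α × Bool)} (h : IsMinimalWord L) : IsReduced L := by
  have h1 := h (MulEquiv.refl _)
  rw [MulEquiv.refl_apply, norm, toWord_mk] at h1
  have h2 : reduce L = L := by
    have h3 := (reduce.red (L := L)).sublist
    exact h3.eq_of_length_le h1
  rw [← h2]
  exact isReduced_toWord (x := mk L)

theorem IsMinimalWord.head_ne {p q : α × Bool} {D : List (α × Bool)}
    (h : IsMinimalWord (q :: (D ++ [p]))) : q ≠ letterInv p := by
  rintro rfl
  have h1 := h (MulAut.conj (mk [p]))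
  have h2 : MulAut.conj (mk [p]) (mk (letterInv p :: (D ++ [p]))) = mk D := by
    have : mk (letterInv p :: (D ++ [p])) = (mk [p])⁻¹ * mk D * mk [p] := by
      rw [← mk_letterInv]; simp [mul_mk]
    rw [this, MulAut.conj_apply]
    group
  rw [h2] at h1
  have h3 := norm_mk_le (L₁ := D)
  simp at h1
  omega

omit [DecidableEq α] in
theorem chain_of_rotations {L : List (α × Bool)} {r : α × Bool → α × Bool → Prop}
    (h : ∀ A C q p, L = A ++ C → (C ++ A).head? = some q → (C ++ A).getLast? = some p → r p q) :
    Cycle.Chain r (L : Cycle (α × Bool)) := by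
  cases L with
  | nil => simp
  | cons x l =>
    rw [Cycle.chain_coe_cons, List.isChain_iff_getElem]
    intro i hi
    have hi' : i < (x :: l).length := by simpa using hi
    refine h ((x :: l).take (i + 1)) ((x :: l).drop (i + 1)) _ _
      (List.take_append_drop _ _).symm ?_ ?_
    · rw [List.head?_append]
      by_cases hl : i + 1 < (x :: l).length
      · rw [List.head?_drop, List.getElem?_eq_getElem hl]
        simp only [← List.cons_append]
        rw [List.getElem_append_left hl]
        rfl
      · have h2 : i = l.length := by simp at hl hi'; omega
        subst h2
        simp
    · rw [List.getLast?_append_of_ne_nil _ (by simp), List.getLast?_take]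
      simp only [← List.cons_append]
      rw [List.getElem_append_left hi']
      simp [List.getElem?_eq_getElem hi']

theorem IsMinimalWord.head?_ne {L : List (α × Bool)} {p q : α × Bool} (h : IsMinimalWord L)
    (hq : L.head? = some q) (hp : L.getLast? = some p) : q ≠ letterInv p := by
  cases L with
  | nil => simp at hq
  | cons x l =>
    obtain rfl : x = q := by simpa using hq
    rcases List.eq_nil_or_concat l with rfl | ⟨D, p', rfl⟩
    · obtain rfl : x = p := by simpa using hp
      exact (letterInv_ne x).symm
    · rw [List.concat_eq_append] at h hp
      obtain rfl : p' = p := by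
        rw [← List.cons_append, List.getLast?_concat] at hp
        simpa using hp
      exact h.head_ne

theorem IsMinimalWord.chain_ne {L : List (α × Bool)} (h : IsMinimalWord L) :
    Cycle.Chain (fun p q => q ≠ letterInv p) (L : Cycle (α × Bool)) :=
  chain_of_rotations fun _ _ _ _ hL hq hp => (hL ▸ h).rotate.head?_ne hq hp

end Whitehead

section Split

variable {k : ℕ}

theorem IsFull.exists_mem {L : List (Fin k × Bool)} (h : IsFull (mk L)) (a : Fin k) :
    ∃ b, (a, b) ∈ L := by
  by_contra! hcon
  let ρ : FreeGroup (Fin k) →* FreeGroup (Fin k) := lift fun b => if b = a then 1 else of b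
  have h1 : ∀ x, ρ (ρ x) = ρ x := by
    intro x
    refine DFunLike.congr_fun (f := ρ.comp ρ) (g := ρ) (ext_hom _ _ fun b => ?_) x
    by_cases hb : b = a <;> simp [ρ, hb]
  have h2 : ∀ L : List (Fin k × Bool), (∀ b, (a, b) ∉ L) → ρ (mk L) = mk L := by
    intro L
    induction L with
    | nil => intro _; exact _root_.map_one ρ
    | cons x L ih =>
      intro hx
      have h3 : mk (x :: L) = mk [x] * mk L := by simp [mul_mk]
      rw [h3, _root_.map_mul, ih fun b hb => hx b (List.mem_cons_of_mem _ hb)]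
      congr 1
      obtain ⟨c, d⟩ := x
      have hc : c ≠ a := by rintro rfl; exact hx d List.mem_cons_self
      cases d <;> simp [ρ, hc, of, inv_mk, FreeGroup.invRev]
  have h3 := h.eq_id ρ h1 (h2 L hcon) (of a)
  simp [ρ] at h3

theorem IsFull.not_chain_iff {L : List (Fin k × Bool)} (h : IsFull (mk L)) (hL : IsMinimalWord L)
    {S : Set (Fin k × Bool)} (hS : S.Nonempty) (hS' : Sᶜ.Nonempty)
    (hch : Cycle.Chain (fun p q => letterInv p ∈ S ↔ q ∈ S) (L : Cycle (Fin k × Bool))) :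
    False := by
  have and_imp : ∀ {r s : Fin k × Bool → Fin k × Bool → Prop},
      Cycle.Chain r (L : Cycle (Fin k × Bool)) → Cycle.Chain s (L : Cycle (Fin k × Bool)) →
      Cycle.Chain (fun p q => r p q ∧ s p q) (L : Cycle (Fin k × Bool)) := by
    intro r s hr hs
    cases L with
    | nil => simp
    | cons x l =>
      rw [Cycle.chain_coe_cons, List.isChain_iff_getElem] at *
      exact fun i hi => ⟨hr i hi, hs i hi⟩
  by_cases hinv : ∃ z ∈ S, letterInv z ∉ S
  · obtain ⟨z, hz, hz'⟩ := hinv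
    have h1 := hL.chain_iff (S := S \ {z}) (y := z) (by simp) (fun h => hz' h.1)
      (hch.imp fun p q hpq => by
        constructor
        · rintro ⟨hp, -⟩
          by_cases hq : q = z
          · exact Or.inr hq
          · exact Or.inl ⟨hpq.1 hp, hq⟩
        · rintro ⟨hq, -⟩
          by_cases hp : letterInv p = z
          · exact Or.inr hp
          · exact Or.inl ⟨hpq.2 hq, hp⟩)
    have h2 : Cycle.Chain (fun p q => letterInv p ≠ z ∧ q ≠ z) (L : Cycle (Fin k × Bool)) := by
      refine (and_imp (and_imp hch h1) hL.chain_ne).imp ?_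
      rintro p q ⟨⟨h3, h4⟩, h5⟩
      constructor
      · rintro rfl
        refine h5 ?_
        by_contra hne
        exact (h4.2 ⟨h3.1 hz, hne⟩).2 rfl
      · rintro rfl
        refine h5 ?_
        by_contra hne
        exact (h4.1 ⟨h3.2 hz, fun h => hne h.symm⟩).2 rfl
    have : IsTrans (Fin k × Bool) (fun p q => letterInv p ≠ z ∧ q ≠ z) :=
      ⟨fun _ _ _ hab hbc => ⟨hab.1, hbc.2⟩⟩
    rw [Cycle.chain_iff_pairwise] at h2
    obtain ⟨b, hb⟩ := h.exists_mem z.1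
    have h3 := h2 _ hb _ hb
    obtain ⟨a, c⟩ := z
    cases b <;> cases c <;> simp_all [letterInv]
  · push Not at hinv
    have hinv' : ∀ z, letterInv z ∈ S ↔ z ∈ S :=
      fun z => ⟨fun hz => by simpa using hinv _ hz, hinv z⟩
    simp only [hinv'] at hch
    have : IsTrans (Fin k × Bool) (fun p q => p ∈ S ↔ q ∈ S) :=
      ⟨fun _ _ _ hab hbc => hab.trans hbc⟩
    rw [Cycle.chain_iff_pairwise] at hch
    have hmem : ∀ z : Fin k × Bool, ∃ z' ∈ L, (z' ∈ S ↔ z ∈ S) := by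
      rintro ⟨a, b⟩
      obtain ⟨c, hc⟩ := h.exists_mem a
      refine ⟨_, hc, ?_⟩
      by_cases hbc : b = c
      · rw [hbc]
      · rw [← hinv' (a, b)]
        have : letterInv (a, b) = (a, c) := by
          cases b <;> cases c <;> first | rfl | exact absurd rfl hbc
        rw [this]
    obtain ⟨z, hz⟩ := hS
    obtain ⟨w, hw⟩ := hS'
    obtain ⟨z', hz', h1⟩ := hmem z
    obtain ⟨w', hw', h2⟩ := hmem w
    exact hw (h2.1 ((hch _ hz' _ hw').1 (h1.2 hz)))

theorem IsFull.not_chain_turn {L : List (Fin k × Bool)} (h : IsFull (mk L))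
    (hL : IsMinimalWord L) {S R : Set (Fin k × Bool)} {y : Fin k × Bool} (hS : S.Nonempty)
    (hR : R.Nonempty) (hSR : Disjoint S R) (hyS : y ∉ S) (hyR : y ∉ R)
    (hall : ∀ x, x ∈ S ∨ x ∈ R ∨ x = y)
    (hch : Cycle.Chain (fun p q => ¬ (letterInv p ∈ S ∧ q ∈ R) ∧ ¬ (letterInv p ∈ R ∧ q ∈ S))
      (L : Cycle (Fin k × Bool))) : False := by
  wlog hy : letterInv y ∉ S generalizing S R
  · rw [not_not] at hy
    refine this hR hS hSR.symm hyR hyS (fun x => ?_) (hch.imp fun p q hpq => ⟨hpq.2, hpq.1⟩)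
      fun h' => Set.disjoint_left.1 hSR hy h'
    have := hall x
    tauto
  refine h.not_chain_iff hL hS ⟨y, hyS⟩ (hL.chain_iff hyS hy (hch.imp fun p q hpq => ?_))
  have h1 := hall q
  have h2 := hall (letterInv p)
  tauto

end Split

section Cone

variable {α : Type*} [DecidableEq α]

omit [DecidableEq α] in
theorem eq_of_fst_eq_iff (a b : α × Bool) : (a.1 = b.1 → a.2 = b.2) ↔ b ≠ letterInv a := by
  obtain ⟨a, c⟩ := a
  obtain ⟨b, d⟩ := b
  cases c <;> cases d <;> simp [letterInv, eq_comm]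

theorem IsMinimalWord.isCyclicallyReduced {L : List (α × Bool)} (h : IsMinimalWord L) :
    IsCyclicallyReduced L := by
  refine ⟨h.isReduced, fun a ha b hb => (eq_of_fst_eq_iff a b).2 ?_⟩
  exact h.head?_ne hb ha

/-- The elements whose reduced word starts with `w`. -/
def cone (w : List (α × Bool)) : Set (FreeGroup α) := {m | w <+: m.toWord}

theorem exists_cone_pure [Finite α] {B : Set (FreeGroup α)}
    (hfin : ∀ x, {m | ¬ (m * x ∈ B ↔ m ∈ B)}.Finite) :
    ∃ N, ∀ w : List (α × Bool), N ≤ w.length → cone w ∩ B = ∅ ∨ cone w ⊆ B := by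
  have hD : (⋃ x : α × Bool, {m | ¬ (m * mk [x] ∈ B ↔ m ∈ B)}).Finite :=
    Set.finite_iUnion fun x => hfin _
  obtain ⟨N, hN⟩ := (hD.image norm).bddAbove
  refine ⟨N + 1, fun w hw => ?_⟩
  have key : ∀ v, IsReduced (w ++ v) → (mk (w ++ v) ∈ B ↔ mk w ∈ B) := by
    intro v
    induction v using List.reverseRecOn with
    | nil => simp
    | append_singleton v x ih =>
      intro hr
      have hr' : IsReduced (w ++ v) :=
        List.IsChain.left_of_append (l₂ := [x]) (by rw [List.append_assoc]; exact hr)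
      rw [← ih hr', ← List.append_assoc, ← mul_mk]
      by_contra hcon
      have h1 := hN ⟨_, Set.mem_iUnion.2 ⟨x, hcon⟩, rfl⟩
      rw [norm, toWord_mk, hr'.reduce_eq, List.length_append] at h1
      omega
  have key' : ∀ m ∈ cone w, (m ∈ B ↔ mk w ∈ B) := by
    rintro m ⟨v, hv⟩
    have := key v (hv ▸ isReduced_toWord)
    rwa [hv, mk_toWord] at this
  by_cases hwB : mk w ∈ B
  · exact Or.inr fun m hm => (key' m hm).2 hwB
  · exact Or.inl (Set.eq_empty_of_forall_notMem fun m hm => hwB ((key' m hm.1).1 hm.2))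

theorem notMem_of_cone {w l : List (α × Bool)} {q : α × Bool} (hw : IsReduced w)
    (hL : IsMinimalWord (q :: l)) (hq : ∀ a ∈ w.getLast?, q ≠ letterInv a)
    {X : Set (FreeGroup α)} (hX : ∀ m, m * mk (q :: l) ∈ X ↔ m ∈ X)
    (hfin : (cone (w ++ [q]) ∩ X).Finite) : mk w ∉ X := by
  intro hwX
  have hred : ∀ n : ℕ, IsReduced (w ++ (List.replicate (n + 1) (q :: l)).flatten) := by
    intro n
    have h1 : IsReduced (w ++ (q :: l)) := by
      refine List.isChain_append.2 ⟨hw, hL.isReduced, fun a ha b hb => ?_⟩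
      obtain rfl : q = b := by simpa using hb
      exact (eq_of_fst_eq_iff a q).2 (hq a ha)
    have := IsReduced.append_flatten_replicate_append (L₁ := w) (L₃ := [])
      hL.isCyclicallyReduced (by simpa using h1) n.succ_ne_zero
    simpa using this
  have hX' : ∀ n : ℕ, mk w * mk (q :: l) ^ n ∈ X := by
    intro n
    induction n with
    | zero => simpa using hwX
    | succ n ih => rw [pow_succ, ← mul_assoc]; exact (hX _).2 ih
  have hword : ∀ n : ℕ, (mk w * mk (q :: l) ^ (n + 1)).toWord =
      w ++ (List.replicate (n + 1) (q :: l)).flatten := by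
    intro n
    rw [pow_mk, mul_mk, toWord_mk, (hred n).reduce_eq]
  refine Set.infinite_of_injective_forall_mem (f := fun n : ℕ => mk w * mk (q :: l) ^ (n + 1))
    (fun n m hnm => ?_) (fun n => Set.mem_inter ?_ (hX' _)) hfin
  · have := congrArg (fun x : FreeGroup α => x.toWord.length) hnm
    simp only [hword, List.length_append, List.length_flatten, List.map_replicate,
      List.sum_replicate, List.length_cons] at this
    simpa using this
  · change _ <+: _
    rw [hword]
    exact ⟨l ++ (List.replicate n (q :: l)).flatten, by simp [List.replicate_succ]⟩

theorem not_cone_turn {w A C : List (α × Bool)} {p q : α × Bool} (hw : IsReduced w)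
    (hL : IsMinimalWord (A ++ C)) (hq : (C ++ A).head? = some q)
    (hp : (C ++ A).getLast? = some p) (hwq : ∀ a ∈ w.getLast?, q ≠ letterInv a)
    (hwp : ∀ a ∈ w.getLast?, letterInv p ≠ letterInv a) {B : Set (FreeGroup α)}
    (hB : ∀ m, m * mk (A ++ C) ∈ B ↔ m ∈ B) (hfin : ∀ x, {m | ¬ (m * x ∈ B ↔ m ∈ B)}.Finite)
    (h₁ : (cone (w ++ [q]) ∩ B).Finite) (h₂ : (cone (w ++ [letterInv p]) \ B).Finite) :
    False := by
  let X : Set (FreeGroup α) := {m | m * (mk A)⁻¹ ∈ B}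
  have hX : ∀ m, m * mk (C ++ A) ∈ X ↔ m ∈ X := by
    intro m
    have h3 : m * mk (C ++ A) * (mk A)⁻¹ = m * (mk A)⁻¹ * mk (A ++ C) := by
      rw [← mul_mk, ← mul_mk]; group
    change m * mk (C ++ A) * (mk A)⁻¹ ∈ B ↔ m * (mk A)⁻¹ ∈ B
    rw [h3, hB]
  have hXB := hfin (mk A)⁻¹
  have hL' := hL.rotate
  generalize C ++ A = L at hL' hq hp hX
  have h3 : mk w ∉ X := by
    cases L with
    | nil => simp at hq
    | cons x l =>
      obtain rfl : x = q := by simpa using hq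
      refine notMem_of_cone hw hL' hwq hX ((h₁.union hXB).subset ?_)
      rintro m ⟨hm, hmX⟩
      by_cases hmB : m ∈ B
      · exact Or.inl ⟨hm, hmB⟩
      · exact Or.inr fun h => hmB (h.1 hmX)
  have h4 : mk w ∉ Xᶜ := by
    rcases List.eq_nil_or_concat L with rfl | ⟨D, x, rfl⟩
    · simp at hp
    rw [List.concat_eq_append] at hL' hX hp
    obtain rfl : x = p := by simpa using hp
    have h5 : FreeGroup.invRev (D ++ [x]) = letterInv x :: FreeGroup.invRev D := by
      simp [FreeGroup.invRev, letterInv]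
    have hL'' := hL'.invRev
    rw [h5] at hL''
    refine notMem_of_cone hw hL'' hwp (fun m => ?_) ((h₂.union hXB).subset ?_)
    · rw [← h5, ← inv_mk]
      have := hX (m * (mk (D ++ [x]))⁻¹)
      rw [inv_mul_cancel_right] at this
      exact not_congr this.symm
    · rintro m ⟨hm, hmX⟩
      by_cases hmB : m ∈ B
      · exact Or.inr fun h => hmX (h.2 hmB)
      · exact Or.inl ⟨hm, hmB⟩
  exact h4 h3

omit [DecidableEq α] in
theorem eq_empty_of_finite {g : FreeGroup α} (hg : g ≠ 1) {X : Set (FreeGroup α)}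
    (hX : ∀ m, m * g ∈ X ↔ m ∈ X) (hfin : X.Finite) : X = ∅ := by
  refine Set.eq_empty_of_forall_notMem fun m hm => ?_
  have hX' : ∀ n : ℕ, m * g ^ n ∈ X := by
    intro n
    induction n with
    | zero => simpa using hm
    | succ n ih => rw [pow_succ, ← mul_assoc]; exact (hX _).2 ih
  refine Set.infinite_of_injective_forall_mem (fun a b hab => ?_) hX' hfin
  exact injective_pow_iff_not_isOfFinOrder.2 (not_isOfFinOrder_of_isMulTorsionFree hg)
    (mul_left_cancel hab)

theorem cone_subset (w : List (α × Bool)) : cone w ⊆ {mk w} ∪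
    ⋃ q : {q : α × Bool // ∀ a ∈ w.getLast?, q ≠ letterInv a}, cone (w ++ [q.1]) := by
  rintro m ⟨v, hv⟩
  cases v with
  | nil => exact Or.inl (by rw [Set.mem_singleton_iff, ← mk_toWord (x := m), ← hv]; simp)
  | cons q v =>
    refine Or.inr (Set.mem_iUnion.2 ⟨⟨q, fun a ha => ?_⟩, v, by simpa using hv⟩)
    have h1 : IsReduced (w ++ q :: v) := hv ▸ isReduced_toWord
    exact (eq_of_fst_eq_iff a q).1 ((List.isChain_append.1 h1).2.2 a ha q (by simp))

end Cone

theorem IsFull.mem_iff_of_minimal {k : ℕ} {L : List (Fin k × Bool)} (h : IsFull (mk L))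
    (hL : IsMinimalWord L) {B : Set (FreeGroup (Fin k))} (hB : ∀ m, m * mk L ∈ B ↔ m ∈ B)
    (hfin : ∀ x, {m | ¬ (m * x ∈ B ↔ m ∈ B)}.Finite) (m m' : FreeGroup (Fin k)) :
    m ∈ B ↔ m' ∈ B := by
  rcases isEmpty_or_nonempty (Fin k) with hk | ⟨⟨a⟩⟩
  · rw [Subsingleton.elim m m']
  have hg : mk L ≠ 1 := by
    obtain ⟨b, hb⟩ := h.exists_mem a
    intro h1
    have h2 := congrArg toWord h1
    rw [toWord_mk, hL.isReduced.reduce_eq, toWord_one] at h2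
    simp [h2] at hb
  by_cases h1 : B.Finite
  · simp [eq_empty_of_finite hg hB h1]
  by_cases h2 : Bᶜ.Finite
  · have := eq_empty_of_finite hg (fun m => not_congr (hB m)) h2
    simp [Set.compl_empty_iff.1 this]
  exfalso
  obtain ⟨N, hN⟩ := exists_cone_pure hfin
  have hpure : ∀ w : List (Fin k × Bool), N ≤ w.length →
      (cone w ∩ B).Finite ∨ (cone w \ B).Finite := by
    intro w hw
    rcases hN w hw with h3 | h3
    · exact Or.inl (h3 ▸ Set.finite_empty)
    · exact Or.inr (by rw [Set.sdiff_eq_empty.2 h3]; exact Set.finite_empty)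
  obtain ⟨w, hw, hmax⟩ : ∃ w : List (Fin k × Bool),
      ¬ ((cone w ∩ B).Finite ∨ (cone w \ B).Finite) ∧
      ∀ q, (cone (w ++ [q]) ∩ B).Finite ∨ (cone (w ++ [q]) \ B).Finite := by
    by_contra! hcon
    have : ∀ n, ∃ w : List (Fin k × Bool), w.length = n ∧
        ¬ ((cone w ∩ B).Finite ∨ (cone w \ B).Finite) := by
      intro n
      induction n with
      | zero =>
        refine ⟨[], rfl, ?_⟩
        have : cone ([] : List (Fin k × Bool)) = Set.univ :=
          Set.eq_univ_of_forall fun m => ⟨_, rfl⟩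
        rw [this, Set.univ_inter, ← Set.compl_eq_univ_sdiff]
        tauto
      | succ n ih =>
        obtain ⟨w, rfl, hw⟩ := ih
        obtain ⟨q, hq⟩ := hcon w (not_or.1 hw)
        exact ⟨w ++ [q], by simp, not_or.2 hq⟩
    obtain ⟨w, hwN, hw⟩ := this N
    exact hw (hpure w hwN.ge)
  rw [not_or] at hw
  have hwred : IsReduced w := by
    by_contra hcon
    refine hw.1 ?_
    have : cone w = ∅ := Set.eq_empty_of_forall_notMem fun m hm =>
      hm.elim fun u hu => hcon (List.IsChain.left_of_append (l₂ := u) (hu ▸ isReduced_toWord))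
    simp [this]
  let ok (q : Fin k × Bool) : Prop := ∀ a ∈ w.getLast?, q ≠ letterInv a
  let S : Set (Fin k × Bool) := {q | ok q ∧ (cone (w ++ [q]) \ B).Finite}
  let R : Set (Fin k × Bool) := {q | ok q ∧ ¬ (cone (w ++ [q]) \ B).Finite}
  have hR : ∀ q ∈ R, (cone (w ++ [q]) ∩ B).Finite := fun q hq => (hmax q).resolve_right hq.2
  have hSne : S.Nonempty := by
    by_contra hcon
    rw [Set.not_nonempty_iff_eq_empty] at hcon
    refine hw.1 (((Set.finite_singleton (mk w)).union (Set.finite_iUnion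
      (f := fun q : {q // ok q} => cone (w ++ [q.1]) ∩ B)
        fun q => hR q.1 ⟨q.2, fun hq => ?_⟩)).subset ?_)
    · exact Set.notMem_empty q.1 (hcon ▸ ⟨q.2, hq⟩)
    · rintro m ⟨hm, hmB⟩
      refine (cone_subset w hm).imp id fun hm' => ?_
      obtain ⟨q, hq⟩ := Set.mem_iUnion.1 hm'
      exact Set.mem_iUnion.2 ⟨q, hq, hmB⟩
  have hRne : R.Nonempty := by
    by_contra hcon
    rw [Set.not_nonempty_iff_eq_empty] at hcon
    refine hw.2 (((Set.finite_singleton (mk w)).union (Set.finite_iUnion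
      (f := fun q : {q // ok q} => cone (w ++ [q.1]) \ B) fun q => ?_)).subset ?_)
    · by_contra hq
      exact Set.notMem_empty q.1 (hcon ▸ ⟨q.2, hq⟩)
    · rintro m ⟨hm, hmB⟩
      refine (cone_subset w hm).imp id fun hm' => ?_
      obtain ⟨q, hq⟩ := Set.mem_iUnion.1 hm'
      exact Set.mem_iUnion.2 ⟨q, hq, hmB⟩
  have hSR : Disjoint S R := Set.disjoint_left.2 fun q hq hq' => hq'.2 hq.2
  have hch : Cycle.Chain (fun p q => ¬ (letterInv p ∈ S ∧ q ∈ R) ∧ ¬ (letterInv p ∈ R ∧ q ∈ S))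
      (L : Cycle (Fin k × Bool)) := by
    refine chain_of_rotations fun A C q p hAC hq hp => ?_
    subst hAC
    constructor
    · rintro ⟨hpS, hqR⟩
      exact not_cone_turn hwred hL hq hp hqR.1 hpS.1 hB hfin (hR q hqR) hpS.2
    · rintro ⟨hpR, hqS⟩
      refine not_cone_turn (B := Bᶜ) hwred hL hq hp hqS.1 hpR.1 (fun m => not_congr (hB m))
        (fun x => ?_) hqS.2 ?_
      · simpa [not_iff_not] using hfin x
      · rw [Set.sdiff_compl]
        exact hR _ hpR
  rcases List.eq_nil_or_concat w with hnil | ⟨D, y, hD⟩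
  · have hok : ∀ q, ok q := fun q => by simp [ok, hnil]
    refine h.not_chain_iff hL hSne (hRne.mono fun q hq hq' => hq.2 hq'.2)
      (hch.imp fun p q hpq => ?_)
    simp only [S, R, Set.mem_ofPred_eq, hok, true_and] at hpq ⊢
    tauto
  · have hok : ∀ q, ok q ↔ q ≠ letterInv y := fun q => by
      simp [ok, hD, List.concat_eq_append]
    refine h.not_chain_turn hL hSne hRne hSR (y := letterInv y) ?_ ?_ (fun q => ?_) hch
    · exact fun h' => (hok _).1 h'.1 rfl
    · exact fun h' => (hok _).1 h'.1 rfl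
    · by_cases hq : q = letterInv y
      · exact Or.inr (Or.inr hq)
      · by_cases hq' : (cone (w ++ [q]) \ B).Finite
        · exact Or.inl ⟨(hok q).2 hq, hq'⟩
        · exact Or.inr (Or.inl ⟨(hok q).2 hq, hq'⟩)

theorem IsFull.map_mulEquiv {k : ℕ} {g : FreeGroup (Fin k)} (h : IsFull g)
    (a : FreeGroup (Fin k) ≃* FreeGroup (Fin k)) : IsFull (a g) := by
  intro k' hk' i p hpi hg
  refine h k' hk' (a.symm.toMonoidHom.comp i) (p.comp a.toMonoidHom) ?_ ?_
  · refine MonoidHom.ext fun x => ?_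
    simpa using DFunLike.congr_fun hpi x
  · simp [hg]

theorem exists_minimalWord {α : Type*} [DecidableEq α] (g : FreeGroup α) :
    ∃ (a : FreeGroup α ≃* FreeGroup α) (L : List (α × Bool)), a g = mk L ∧ IsMinimalWord L := by
  classical
  have hex : ∃ n, ∃ a : FreeGroup α ≃* FreeGroup α, (a g).norm = n := ⟨_, MulEquiv.refl _, rfl⟩
  obtain ⟨a, ha⟩ := Nat.find_spec hex
  refine ⟨a, (a g).toWord, mk_toWord.symm, fun b => ?_⟩
  rw [mk_toWord]
  change (a g).norm ≤ _
  rw [ha]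
  exact Nat.find_min' hex ⟨a.trans b, rfl⟩

/-- A subset of a free group invariant under left multiplication by a full element and almost
invariant under all left multiplications is trivial. -/
theorem IsFull.mem_iff_mem {k : ℕ} {g : FreeGroup (Fin k)} (h : IsFull g)
    {A : Set (FreeGroup (Fin k))} (hA : ∀ m, g * m ∈ A ↔ m ∈ A)
    (hfin : ∀ x, {m | ¬ (x * m ∈ A ↔ m ∈ A)}.Finite) (m m' : FreeGroup (Fin k)) :
    m ∈ A ↔ m' ∈ A := by
  obtain ⟨a, L, haL, hL⟩ := exists_minimalWord g
  let B : Set (FreeGroup (Fin k)) := {m | a.symm m⁻¹ ∈ A}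
  have hB : ∀ m x, m * x ∈ B ↔ (a.symm x)⁻¹ * a.symm m⁻¹ ∈ A := by
    intro m x
    simp [B, -inv_mk, -mul_mk]
  have hinv : ∀ m, m * mk L ∈ B ↔ m ∈ B := by
    intro m
    rw [hB, ← haL, MulEquiv.symm_apply_apply, ← hA, mul_inv_cancel_left]
    rfl
  have hBfin : ∀ x, {m | ¬ (m * x ∈ B ↔ m ∈ B)}.Finite := by
    intro x
    refine ((hfin (a.symm x)⁻¹).image fun m => (a m)⁻¹).subset fun m hm => ?_
    refine ⟨a.symm m⁻¹, ?_, by simp⟩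
    rw [Set.mem_ofPred_eq, hB] at hm
    exact hm
  have := (haL ▸ h.map_mulEquiv a : IsFull (mk L)).mem_iff_of_minimal hL hinv hBfin (a m)⁻¹ (a m')⁻¹
  simpa [B] using this

theorem IsFull.character_eq {k r : ℕ} {g : FreeGroup (Fin k)} (hg : IsFull g)
    {p : FreeGroup (Fin r) →* FreeGroup (Fin k)} {s t : FreeGroup (Fin k) →* FreeGroup (Fin r)}
    (hs : ∀ x, p (s x) = x) (ht : ∀ x, p (t x) = x) (hst : s g = t g)
    (hgen : ∀ E : Subgroup (FreeGroup (Fin r)), (∀ x, s x ∈ E) → (∀ x, t x ∈ E) → ∀ x, x ∈ E)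
    {Γ : Type*} [CommGroup Γ] (χ : FreeGroup (Fin r) →* Γ) (x : FreeGroup (Fin r)) :
    χ (t (p x)) = χ x := by
  classical
  let π : FreeGroup (Fin r) →* Equiv.Perm (FreeGroup (Fin k)) :=
    (MulAction.toPermHom (FreeGroup (Fin k)) (FreeGroup (Fin k))).comp p
  have hπ : ∀ x m, π x m = p x * m := fun x m => rfl
  obtain ⟨c, hc₀, hc⟩ := exists_cocycle π fun i m => if m = 1 then χ (of i) else 1
  have hsupp : ∀ x, (mulSupport (c x)).Finite := by
    intro x
    induction x using FreeGroup.induction_on with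
    | C1 =>
      have : c 1 = 1 := funext (cocycle_one hc)
      simp [this]
    | of i =>
      refine (Set.finite_singleton 1).subset fun m hm => ?_
      by_contra hne
      refine hm ?_
      rw [hc₀]
      exact if_neg hne
    | inv_of i ih =>
      refine (ih.image (π (of i))).subset fun m hm => ?_
      obtain ⟨m, rfl⟩ := (π (of i)).surjective m
      refine ⟨m, fun h => hm ?_, rfl⟩
      rw [cocycle_inv hc, h, inv_one]
    | mul x y hx hy =>
      refine ((hx.preimage (π y).injective.injOn).union hy).subset fun m hm => ?_
      by_contra hcon
      simp only [Set.mem_union, Set.mem_preimage, mem_mulSupport, not_or, not_not] at hcon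
      exact hm (by rw [hc, hcon.1, hcon.2, one_mul])
  let A : Set (FreeGroup (Fin k)) := {m | c (s m) 1 = c (t m) 1}
  have hstep : ∀ x m, c (s x) m = c (t x) m → (x * m ∈ A ↔ m ∈ A) := by
    intro x m h
    change c (s (x * m)) 1 = c (t (x * m)) 1 ↔ c (s m) 1 = c (t m) 1
    rw [_root_.map_mul, _root_.map_mul, hc, hc, hπ, hπ, hs, ht, mul_one, h, mul_right_inj]
  have hA : ∀ m, m ∈ A := by
    intro m
    refine (hg.mem_iff_mem (A := A) (fun m => hstep g m (by rw [hst])) (fun x => ?_) m 1).2 ?_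
    · refine ((hsupp (s x)).union (hsupp (t x))).subset fun m hm => ?_
      by_contra hcon
      simp only [Set.mem_union, mem_mulSupport, not_or, not_not] at hcon
      exact hm (hstep x m (hcon.1.trans hcon.2.symm))
    · change c (s 1) 1 = c (t 1) 1
      simp only [_root_.map_one]
  have hcst : ∀ x m, c (s x) m = c (t x) m := by
    intro x m
    have h1 := hA (x * m)
    change c (s (x * m)) 1 = c (t (x * m)) 1 at h1
    have h2 : c (s m) 1 = c (t m) 1 := hA m
    rwa [_root_.map_mul, _root_.map_mul, hc, hc, hπ, hπ, hs, ht, mul_one, h2,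
      mul_left_inj] at h1
  let E : Subgroup (FreeGroup (Fin r)) :=
    { carrier := {x | ∀ m, c x m = c (t (p x)) m}
      one_mem' := fun m => by simp only [_root_.map_one]
      mul_mem' := fun {x y} hx hy m => by
        rw [_root_.map_mul, _root_.map_mul, hc, hc, hx, hy, hπ, hπ, ht]
      inv_mem' := fun {x} hx m => by
        obtain ⟨m, rfl⟩ := (π x).surjective m
        have h1 : π (t (p x)) m = π x m := by rw [hπ, hπ, ht]
        rw [cocycle_inv hc, _root_.map_inv, _root_.map_inv, ← h1, cocycle_inv hc, hx] }
  have hE : ∀ x m, c x m = c (t (p x)) m := by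
    refine hgen E (fun x m => ?_) (fun x m => ?_)
    · rw [hs, hcst]
    · rw [ht]
  let ε : FreeGroup (Fin r) →* Γ :=
    { toFun := fun x => ∏ᶠ m, c x m
      map_one' := finprod_eq_one_of_forall_eq_one (cocycle_one hc)
      map_mul' := fun x y => by
        simp only [hc]
        rw [finprod_mul_distrib ((hsupp x).preimage (π y).injective.injOn) (hsupp y)]
        congr 1
        exact finprod_comp_equiv (π y) }
  have hε : ε = χ := by
    refine ext_hom _ _ fun i => ?_
    change ∏ᶠ m, c (of i) m = χ (of i)
    rw [hc₀, finprod_eq_single _ 1 fun m hm => if_neg hm]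
    exact if_pos rfl
  rw [← hε]
  exact finprod_congr fun m => (hE x m).symm

theorem IsFull.section_eq_of_generate {k r : ℕ} {g : FreeGroup (Fin k)} (hg : IsFull g)
    {p : FreeGroup (Fin r) →* FreeGroup (Fin k)} {s t : FreeGroup (Fin k) →* FreeGroup (Fin r)}
    (hs : ∀ x, p (s x) = x) (ht : ∀ x, p (t x) = x) (hst : s g = t g)
    (hgen : ∀ E : Subgroup (FreeGroup (Fin r)), (∀ x, s x ∈ E) → (∀ x, t x ∈ E) → ∀ x, x ∈ E)
    (x : FreeGroup (Fin k)) : s x = t x := by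
  have hle : r ≤ k := by
    have := (finite_and_card_le_of_injective t fun χ₁ χ₂ h => MonoidHom.ext fun x => by
      rw [← hg.character_eq hs ht hst hgen χ₁ x, ← hg.character_eq hs ht hst hgen χ₂ x]
      exact DFunLike.congr_fun h (p x)).2
    simpa using this
  exact injective_of_surjective_of_le hle p (fun x => ⟨_, hs x⟩) ((hs x).trans (ht x).symm)

/-- Two sections of a homomorphism between free groups that agree on a full element are equal. -/
theorem IsFull.section_eq {k r : ℕ} {g : FreeGroup (Fin k)} (hg : IsFull g)
    {p : FreeGroup (Fin r) →* FreeGroup (Fin k)} {s t : FreeGroup (Fin k) →* FreeGroup (Fin r)}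
    (hs : ∀ x, p (s x) = x) (ht : ∀ x, p (t x) = x) (hst : s g = t g)
    (x : FreeGroup (Fin k)) : s x = t x := by
  let θ : FreeGroup (Fin k ⊕ Fin k) →* FreeGroup (Fin r) :=
    lift (Sum.elim (fun i => s (of i)) fun i => t (of i))
  obtain ⟨r', -, q, j, hq, hj, hjq⟩ := exists_factor θ
  let s' : FreeGroup (Fin k) →* FreeGroup (Fin r') := q.comp (map Sum.inl)
  let t' : FreeGroup (Fin k) →* FreeGroup (Fin r') := q.comp (map Sum.inr)
  have hs' : ∀ x, j (s' x) = s x := by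
    refine DFunLike.congr_fun (f := j.comp s') (g := s) (ext_hom _ _ fun i => ?_)
    have := DFunLike.congr_fun hjq (of (Sum.inl i))
    simpa [θ, s'] using this
  have ht' : ∀ x, j (t' x) = t x := by
    refine DFunLike.congr_fun (f := j.comp t') (g := t) (ext_hom _ _ fun i => ?_)
    have := DFunLike.congr_fun hjq (of (Sum.inr i))
    simpa [θ, t'] using this
  rw [← hs', ← ht']
  refine congrArg j (hg.section_eq_of_generate (p := p.comp j) (s := s') (t := t') (fun x => ?_)
    (fun x => ?_) (hj ?_) (fun E hsE htE x => ?_) x)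
  · rw [MonoidHom.comp_apply, hs', hs]
  · rw [MonoidHom.comp_apply, ht', ht]
  · rw [hs', ht', hst]
  · obtain ⟨y, rfl⟩ := hq x
    induction y using FreeGroup.induction_on with
    | C1 => rw [_root_.map_one]; exact one_mem E
    | of i =>
      cases i with
      | inl i => simpa [s'] using hsE (of i)
      | inr i => simpa [t'] using htE (of i)
    | inv_of i ih => rw [_root_.map_inv]; exact inv_mem ih
    | mul y z hy hz => rw [_root_.map_mul]; exact mul_mem hy hz

end FreeGroup

/-- The intersection of an arbitrary family of verbally closed subgroups of a
free group of finite rank is verbally closed. -/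
theorem verballyClosed_iInf {r : ℕ} {ι : Sort*}
    (H : ι → Subgroup (FreeGroup (Fin r)))
    (hvc : ∀ i, VerballyClosedIn (H i)) :
    VerballyClosedIn (⨅ i, H i) := by
  intro n w h hh ⟨x, hx⟩
  obtain ⟨k, -, i, p, hpi, hfix, hfull⟩ := FreeGroup.exists_isFull_retract h
  have hpi' : ∀ y, p (i y) = y := DFunLike.congr_fun hpi
  have hrange : ∀ y, i y ∈ ⨅ i, H i := by
    intro y
    refine Subgroup.mem_iInf.2 fun a => ?_
    obtain ⟨z, hz, hzh⟩ := hvc a r h h (Subgroup.mem_iInf.1 hh a)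
      ⟨FreeGroup.of, FreeGroup.lift_of_apply h⟩
    have hmem : ∀ u, FreeGroup.lift z u ∈ H a := by
      intro u
      have := FreeGroup.range_lift_le (f := z) (s := H a) (by rintro _ ⟨j, rfl⟩; exact hz j)
      exact this ⟨u, rfl⟩
    let θ : FreeGroup (Fin k) →* FreeGroup (Fin k) := p.comp ((FreeGroup.lift z).comp i)
    have hθ : θ (p h) = p h := by simp only [θ, MonoidHom.comp_apply, hfix, hzh]
    let e : FreeGroup (Fin k) ≃* FreeGroup (Fin k) :=
      MulEquiv.ofBijective θ (hfull.bijective θ hθ)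
    have he : ∀ u, p (FreeGroup.lift z (i u)) = e u := fun _ => rfl
    have heh : e.symm (p h) = p h := by rw [MulEquiv.symm_apply_eq]; exact hθ.symm
    have := hfull.section_eq (p := p) (s := i)
      (t := ((FreeGroup.lift z).comp i).comp e.symm.toMonoidHom) hpi'
      (fun u => by
        change p (FreeGroup.lift z (i (e.symm u))) = u
        rw [he, MulEquiv.apply_symm_apply])
      (by
        change i (p h) = FreeGroup.lift z (i (e.symm (p h)))
        rw [heh, hfix, hzh]) y
    rw [this]
    exact hmem _
  refine ⟨fun j => i (p (x j)), fun j => hrange _, ?_⟩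
  have hcomp : FreeGroup.lift (fun j => i (p (x j))) = (i.comp p).comp (FreeGroup.lift x) :=
    FreeGroup.ext_hom _ _ fun j => by simp
  rw [hcomp, MonoidHom.comp_apply, hx, MonoidHom.comp_apply, hfix]
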